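/- Every permutation π is expressible as an inflation σ[π_1, …, π_n] of a unique simple permutation σ; moreover if |σ| ≥ 4 the intervals π_1, …, π_n are unique. -/

import Mathlib

/-- `I` is an interval of the permutation `π`: a nonempty set of positions that is
contiguous and whose image under `π` is contiguous. -/
def IsPermInterval {n : ℕ} (π : Equiv.Perm (Fin n)) (I : Set (Fin n)) : Prop :=
  I.Nonempty ∧
  (∀ a b e : Fin n, a ∈ I → b ∈ I → a ≤ e → e ≤ b → e ∈ I) ∧
  (∀ a b e : Fin n, a ∈ I → b ∈ I → π a ≤ π e → π e ≤ π b → e ∈ I)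

/-- A permutation is simple if its only intervals are singletons and the whole set. -/
def IsSimplePerm {n : ℕ} (π : Equiv.Perm (Fin n)) : Prop :=
  ∀ I : Set (Fin n), IsPermInterval π I → (∃ i, I = {i}) ∨ I = Set.univ

/-- `c` witnesses that `π` is an inflation `σ[π_1, …, π_s]` of `σ`: `c` assigns
each position of `π` to a block (monotonically and surjectively, so the blocks
are nonempty contiguous sets of positions), the block values are contiguous
(order-convex), and distinct blocks compare according to `σ`. -/
def IsBlockMap {n s : ℕ} (π : Equiv.Perm (Fin n)) (σ : Equiv.Perm (Fin s))
    (c : Fin n → Fin s) : Prop :=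
  Monotone c ∧ Function.Surjective c ∧
  (∀ a b : Fin n, c a < c b → (π a < π b ↔ σ (c a) < σ (c b))) ∧
  (∀ a b e : Fin n, c a = c b → π a ≤ π e → π e ≤ π b → c e = c a)

theorem bm_pos {n s : ℕ} {π : Equiv.Perm (Fin n)} {σ : Equiv.Perm (Fin s)}
    {c : Fin n → Fin s} (h : IsBlockMap π σ c) {a b : Fin n} (hab : c a ≠ c b) :
    a < b ↔ c a < c b := by
  constructor
  · intro hlt
    exact lt_of_le_of_ne (h.1 hlt.le) hab
  · intro hlt
    by_contra hc
    exact absurd (h.1 (not_lt.1 hc)) (not_le.2 hlt)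

theorem bm_val {n s : ℕ} {π : Equiv.Perm (Fin n)} {σ : Equiv.Perm (Fin s)}
    {c : Fin n → Fin s} (h : IsBlockMap π σ c) {a b : Fin n} (hab : c a ≠ c b) :
    π a < π b ↔ σ (c a) < σ (c b) := by
  rcases lt_or_gt_of_ne hab with hlt | hlt
  · exact h.2.2.1 a b hlt
  · have h1 := h.2.2.1 b a hlt
    have h2 : π a ≠ π b := fun e => hab (by rw [π.injective e])
    have h3 : σ (c a) ≠ σ (c b) := fun e => hab (σ.injective e)
    constructor
    · intro h4
      by_contra h5
      exact absurd (h1.2 (lt_of_le_of_ne (not_lt.1 h5) h3.symm)) (not_lt.2 h4.le)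
    · intro h4
      by_contra h5
      exact absurd (h1.1 (lt_of_le_of_ne (not_lt.1 h5) h2.symm)) (not_lt.2 h4.le)

theorem bm_image {n s : ℕ} {π : Equiv.Perm (Fin n)} {σ : Equiv.Perm (Fin s)}
    {c : Fin n → Fin s} (h : IsBlockMap π σ c) {I : Set (Fin n)}
    (hI : IsPermInterval π I) : IsPermInterval σ (c '' I) := by
  refine ⟨hI.1.image c, ?_, ?_⟩
  · rintro _ _ e ⟨a, ha, rfl⟩ ⟨b, hb, rfl⟩ h1 h2
    obtain ⟨x, rfl⟩ := h.2.1 e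
    by_cases e1 : c a = c x
    · exact ⟨a, ha, e1⟩
    by_cases e2 : c x = c b
    · exact ⟨b, hb, e2.symm⟩
    exact ⟨x, hI.2.1 a b x ha hb ((bm_pos h e1).2 (lt_of_le_of_ne h1 e1)).le
      ((bm_pos h e2).2 (lt_of_le_of_ne h2 e2)).le, rfl⟩
  · rintro _ _ e ⟨a, ha, rfl⟩ ⟨b, hb, rfl⟩ h1 h2
    obtain ⟨x, rfl⟩ := h.2.1 e
    by_cases e1 : c a = c x
    · exact ⟨a, ha, e1⟩
    by_cases e2 : c x = c b
    · exact ⟨b, hb, e2.symm⟩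
    exact ⟨x, hI.2.2 a b x ha hb
      ((bm_val h e1).2 (lt_of_le_of_ne h1 (fun e => e1 (σ.injective e)))).le
      ((bm_val h e2).2 (lt_of_le_of_ne h2 (fun e => e2 (σ.injective e)))).le, rfl⟩

theorem bm_fiber {n s : ℕ} {π : Equiv.Perm (Fin n)} {σ : Equiv.Perm (Fin s)}
    {c : Fin n → Fin s} (h : IsBlockMap π σ c) (i : Fin s) :
    IsPermInterval π {x | c x = i} := by
  refine ⟨h.2.1 i, ?_, ?_⟩
  · intro a b e ha hb h1 h2
    have h3 := h.1 h1
    have h4 := h.1 h2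
    simp only [Set.mem_ofPred_eq] at *
    rw [ha] at h3
    rw [hb] at h4
    exact le_antisymm h4 h3
  · intro a b e ha hb h1 h2
    simp only [Set.mem_ofPred_eq] at *
    rw [← ha]
    exact h.2.2.2 a b e (ha.trans hb.symm) h1 h2

theorem simple_corner {s : ℕ} {σ : Equiv.Perm (Fin s)} (hs : 2 ≤ s) (hσ : IsSimplePerm σ)
    (b : Fin s) (h1 : (∀ i, b ≤ i) ∨ (∀ i, i ≤ b))
    (h2 : (∀ i, σ b ≤ σ i) ∨ (∀ i, σ i ≤ σ b)) : s = 2 := by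
  have hnt : Nontrivial (Fin s) := Fin.nontrivial_iff_two_le.2 hs
  have hI : IsPermInterval σ {b}ᶜ := by
    refine ⟨?_, ?_, ?_⟩
    · obtain ⟨x, hx⟩ := exists_ne b
      exact ⟨x, hx⟩
    · rintro x y e hx hy h3 h4 rfl
      rcases h1 with h1 | h1
      · exact hx (le_antisymm h3 (h1 x))
      · exact hy (le_antisymm (h1 y) h4)
    · rintro x y e hx hy h3 h4 rfl
      rcases h2 with h2 | h2
      · exact hx (σ.injective (le_antisymm h3 (h2 x)))
      · exact hy (σ.injective (le_antisymm (h2 y) h4))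
  rcases hσ _ hI with ⟨i, hi⟩ | hu
  · have hun : (Finset.univ : Finset (Fin s)) ⊆ {b, i} := by
      intro x _
      by_cases hx : x = b
      · simp [hx]
      · have : x ∈ ({b}ᶜ : Set (Fin s)) := hx
        rw [hi] at this
        simp [Set.mem_singleton_iff.1 this]
    have h3 := Finset.card_le_card hun
    have h4 := Finset.card_le_two (a := b) (b := i)
    simp at h3
    omega
  · have : b ∈ ({b}ᶜ : Set (Fin s)) := by rw [hu]; trivial
    exact absurd rfl this

theorem both_two {n s₁ s₂ : ℕ} {π : Equiv.Perm (Fin n)} {σ₁ : Equiv.Perm (Fin s₁)}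
    {σ₂ : Equiv.Perm (Fin s₂)} {c₁ : Fin n → Fin s₁} {c₂ : Fin n → Fin s₂}
    (hs₁ : 2 ≤ s₁) (hs₂ : 2 ≤ s₂) (hσ₂ : IsSimplePerm σ₂)
    (h₁ : IsBlockMap π σ₁ c₁) (h₂ : IsBlockMap π σ₂ c₂) (a : Fin s₁) (b : Fin s₂)
    (ha : ∀ j, ∃ x, c₁ x = a ∧ c₂ x = j) (hb : ∀ i, ∃ x, c₂ x = b ∧ c₁ x = i) : s₂ = 2 := by
  have hnt : Nontrivial (Fin s₁) := Fin.nontrivial_iff_two_le.2 hs₁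
  obtain ⟨a', ha'⟩ := exists_ne a
  obtain ⟨y, hyb, hya⟩ := hb a'
  have hF := bm_fiber h₁ a
  have hy : y ∉ {x | c₁ x = a} := fun h => ha' (hya.symm.trans h)
  apply simple_corner hs₂ hσ₂ b
  · by_contra hc
    push Not at hc
    obtain ⟨⟨i, hi⟩, ⟨j, hj⟩⟩ := hc
    obtain ⟨x, hx, hxi⟩ := ha i
    obtain ⟨z, hz, hzj⟩ := ha j
    apply hy
    refine hF.2.1 x z y hx hz (le_of_lt ?_) (le_of_lt ?_)
    · rw [bm_pos h₂ (by rw [hxi, hyb]; exact hi.ne), hxi, hyb]; exact hi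
    · rw [bm_pos h₂ (by rw [hzj, hyb]; exact hj.ne), hzj, hyb]; exact hj
  · by_contra hc
    push Not at hc
    obtain ⟨⟨i, hi⟩, ⟨j, hj⟩⟩ := hc
    obtain ⟨x, hx, hxi⟩ := ha i
    obtain ⟨z, hz, hzj⟩ := ha j
    apply hy
    refine hF.2.2 x z y hx hz (le_of_lt ?_) (le_of_lt ?_)
    · rw [bm_val h₂ (by rw [hxi, hyb]; rintro rfl; exact lt_irrefl _ hi), hxi, hyb]; exact hi
    · rw [bm_val h₂ (by rw [hzj, hyb]; rintro rfl; exact lt_irrefl _ hj), hzj, hyb]; exact hj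

theorem factor {n s₁ s₂ : ℕ} {π : Equiv.Perm (Fin n)} {σ₁ : Equiv.Perm (Fin s₁)}
    {σ₂ : Equiv.Perm (Fin s₂)} {c₁ : Fin n → Fin s₁} {c₂ : Fin n → Fin s₂}
    (hs₂ : 2 ≤ s₂) (hσ₁ : IsSimplePerm σ₁)
    (h₁ : IsBlockMap π σ₁ c₁) (h₂ : IsBlockMap π σ₂ c₂)
    (hf : ∀ a, ∃ b, ∀ x, c₁ x = a → c₂ x = b) :
    ∃ e : Fin s₁ ≃o Fin s₂, (∀ a, σ₂ (e a) = e (σ₁ a)) ∧ ∀ x, c₂ x = e (c₁ x) := by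
  have hnt : Nontrivial (Fin s₂) := Fin.nontrivial_iff_two_le.2 hs₂
  choose g hg using hf
  have hg' : ∀ x, c₂ x = g (c₁ x) := fun x => hg _ x rfl
  have hinj : Function.Injective g := by
    intro a a' haa
    have hI := bm_image h₁ (bm_fiber h₂ (g a))
    have hmem : ∀ i, i ∈ c₁ '' {x | c₂ x = g a} ↔ g i = g a := by
      intro i
      constructor
      · rintro ⟨x, hx, rfl⟩
        rw [← hg' x]; exact hx
      · intro hi
        obtain ⟨x, rfl⟩ := h₁.2.1 i
        exact ⟨x, (hg' x).trans hi, rfl⟩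
    rcases hσ₁ _ hI with ⟨i, hi⟩ | hu
    · have e1 := (hmem a).2 rfl
      have e2 := (hmem a').2 haa.symm
      rw [hi] at e1 e2
      exact e1.trans e2.symm
    · exfalso
      obtain ⟨b, hb⟩ := exists_ne (g a)
      obtain ⟨x, rfl⟩ := h₂.2.1 b
      apply hb
      rw [hg' x, ← hmem, hu]
      trivial
  have hmono : StrictMono g := by
    intro a a' haa
    obtain ⟨x, rfl⟩ := h₁.2.1 a
    obtain ⟨x', rfl⟩ := h₁.2.1 a'
    have hxx := (bm_pos h₁ haa.ne).2 haa
    have := h₂.1 hxx.le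
    rw [hg', hg'] at this
    exact lt_of_le_of_ne this (fun e => haa.ne (hinj e))
  have hsurj : Function.Surjective g := by
    intro b
    obtain ⟨x, rfl⟩ := h₂.2.1 b
    exact ⟨_, (hg' x).symm⟩
  let e : Fin s₁ ≃o Fin s₂ := hmono.orderIsoOfSurjective g hsurj
  have he : ∀ a, e a = g a := fun a => rfl
  have hm2 : StrictMono (fun i => σ₂ (g (σ₁.symm i))) := by
    intro i j hij
    obtain ⟨x, hx⟩ := h₁.2.1 (σ₁.symm i)
    obtain ⟨y, hy⟩ := h₁.2.1 (σ₁.symm j)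
    have hne : c₁ x ≠ c₁ y := by
      rw [hx, hy]
      exact fun e => hij.ne (σ₁.symm.injective e)
    have hne2 : c₂ x ≠ c₂ y := by
      rw [hg', hg']
      exact fun e => hne (hinj e)
    have h3 : π x < π y := by
      rw [bm_val h₁ hne, hx, hy]
      simpa using hij
    rw [bm_val h₂ hne2, hg', hg', hx, hy] at h3
    exact h3
  have hs2 : Function.Surjective (fun i => σ₂ (g (σ₁.symm i))) :=
    σ₂.surjective.comp (hsurj.comp σ₁.symm.surjective)
  let e' : Fin s₁ ≃o Fin s₂ := hm2.orderIsoOfSurjective _ hs2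
  have hee : e' = e := Subsingleton.elim _ _
  refine ⟨e, ?_, fun x => hg' x⟩
  intro a
  have h5 : e' (σ₁ a) = σ₂ (g (σ₁.symm (σ₁ a))) := rfl
  rw [← hee, h5, Equiv.symm_apply_apply, hee]
  rfl

theorem dichotomy {n s₁ s₂ : ℕ} {π : Equiv.Perm (Fin n)} {σ₁ : Equiv.Perm (Fin s₁)}
    {σ₂ : Equiv.Perm (Fin s₂)} {c₁ : Fin n → Fin s₁} {c₂ : Fin n → Fin s₂}
    (hσ₂ : IsSimplePerm σ₂)
    (h₁ : IsBlockMap π σ₁ c₁) (h₂ : IsBlockMap π σ₂ c₂) :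
    (∀ a, ∃ b, ∀ x, c₁ x = a → c₂ x = b) ∨ ∃ a, ∀ j, ∃ x, c₁ x = a ∧ c₂ x = j := by
  by_contra hc
  push Not at hc
  obtain ⟨⟨a, ha⟩, hc⟩ := hc
  obtain ⟨j, hj⟩ := hc a
  rcases hσ₂ _ (bm_image h₂ (bm_fiber h₁ a)) with ⟨i, hi⟩ | hu
  · obtain ⟨x, hx, hxi⟩ := ha i
    apply hxi
    have : c₂ x ∈ c₂ '' {x | c₁ x = a} := ⟨x, hx, rfl⟩
    rw [hi] at this
    exact this
  · have : j ∈ c₂ '' {x | c₁ x = a} := by rw [hu]; trivial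
    obtain ⟨x, hx, hxj⟩ := this
    exact hj x hx hxj

theorem perm_two (σ τ : Equiv.Perm (Fin 2)) (h : σ 0 < σ 1 ↔ τ 0 < τ 1) : σ = τ := by
  revert σ τ
  decide

theorem uniq {n s₁ s₂ : ℕ} {π : Equiv.Perm (Fin n)} {σ₁ : Equiv.Perm (Fin s₁)}
    {σ₂ : Equiv.Perm (Fin s₂)} {c₁ : Fin n → Fin s₁} {c₂ : Fin n → Fin s₂}
    (hs₁ : 2 ≤ s₁) (hs₂ : 2 ≤ s₂) (hσ₁ : IsSimplePerm σ₁) (hσ₂ : IsSimplePerm σ₂)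
    (h₁ : IsBlockMap π σ₁ c₁) (h₂ : IsBlockMap π σ₂ c₂) :
    ∃ e : Fin s₁ ≃o Fin s₂, (∀ a, σ₂ (e a) = e (σ₁ a)) ∧
      (s₁ = 2 ∨ ∀ x, c₂ x = e (c₁ x)) := by
  rcases dichotomy hσ₂ h₁ h₂ with hf | ⟨a, ha⟩
  · obtain ⟨e, he, he'⟩ := factor hs₂ hσ₁ h₁ h₂ hf
    exact ⟨e, he, Or.inr he'⟩
  rcases dichotomy hσ₁ h₂ h₁ with hf | ⟨b, hb⟩
  · obtain ⟨e, he, he'⟩ := factor hs₁ hσ₂ h₂ h₁ hf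
    refine ⟨e.symm, ?_, Or.inr ?_⟩
    · intro i
      rw [OrderIso.eq_symm_apply, ← he, OrderIso.apply_symm_apply]
    · intro x
      rw [he', OrderIso.symm_apply_apply]
  have e2 := both_two hs₁ hs₂ hσ₂ h₁ h₂ a b ha hb
  have e1 := both_two hs₂ hs₁ hσ₁ h₂ h₁ b a hb ha
  subst e1 e2
  obtain ⟨a', ha'⟩ := exists_ne a
  obtain ⟨b', hb'⟩ := exists_ne b
  obtain ⟨x, hxa, hxb⟩ := ha b'
  obtain ⟨y, hyb, hya⟩ := hb a'
  have hsep : ∃ u v : Fin n, c₁ u < c₁ v ∧ c₂ u < c₂ v := by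
    have n1 : c₁ x ≠ c₁ y := by rw [hxa, hya]; exact ha'.symm
    have n2 : c₂ x ≠ c₂ y := by rw [hxb, hyb]; exact hb'
    rcases lt_or_gt_of_ne n1 with h | h
    · exact ⟨x, y, h, (bm_pos h₂ n2).1 ((bm_pos h₁ n1).2 h)⟩
    · exact ⟨y, x, h, (bm_pos h₂ n2.symm).1 ((bm_pos h₁ n1.symm).2 h)⟩
  obtain ⟨u, v, l1, l2⟩ := hsep
  have key : ∀ p q : Fin 2, p < q → p = 0 ∧ q = 1 := by decide
  have v1 := h₁.2.2.1 u v l1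
  have v2 := h₂.2.2.1 u v l2
  rw [(key _ _ l1).1, (key _ _ l1).2] at v1
  rw [(key _ _ l2).1, (key _ _ l2).2] at v2
  refine ⟨OrderIso.refl _, ?_, Or.inl rfl⟩
  intro i
  rw [perm_two σ₁ σ₂ (v1.symm.trans v2)]
  rfl

theorem standardize {t s : ℕ} (f : Fin t → Fin s) (hf : Function.Injective f) :
    ∃ τ : Equiv.Perm (Fin t), ∀ i j, τ i < τ j ↔ f i < f j := by
  have hm : StrictMono (f ∘ Tuple.sort f) :=
    (Tuple.monotone_sort f).strictMono_of_injective (hf.comp (Tuple.sort f).injective)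
  refine ⟨(Tuple.sort f).symm, fun i j => ?_⟩
  rw [← hm.lt_iff_lt]
  simp

theorem contract {s : ℕ} (σ : Equiv.Perm (Fin s)) (hσ : ¬ IsSimplePerm σ) :
    ∃ (t : ℕ) (τ : Equiv.Perm (Fin t)) (d : Fin s → Fin t), 2 ≤ t ∧ t < s ∧ IsBlockMap σ τ d := by
  classical
  unfold IsSimplePerm at hσ
  push Not at hσ
  obtain ⟨J, hJ, hJ1, hJ2⟩ := hσ
  obtain ⟨p, hp⟩ := hJ.1
  obtain ⟨q, hq, hqp⟩ : ∃ q ∈ J, q ≠ p := by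
    by_contra hc
    push Not at hc
    exact hJ1 p (Set.eq_singleton_iff_unique_mem.2 ⟨hp, hc⟩)
  obtain ⟨r, hr⟩ := (Set.ne_univ_iff_exists_notMem J).1 hJ2
  let R : Finset (Fin s) := Finset.univ.filter (fun i => i = p ∨ i ∉ J)
  have hR : ∀ i, i ∈ R ↔ i = p ∨ i ∉ J := by simp [R]
  let E : Fin R.card ≃o R := R.orderIsoOfFin rfl
  let ρ : Fin s → R := fun i => if h : i ∈ J then ⟨p, (hR p).2 (Or.inl rfl)⟩
    else ⟨i, (hR i).2 (Or.inr h)⟩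
  have ρ1 : ∀ i, i ∈ J → (ρ i : Fin s) = p := fun i h => by simp [ρ, h]
  have ρ2 : ∀ i, i ∉ J → (ρ i : Fin s) = i := fun i h => by simp [ρ, h]
  have hρm : Monotone ρ := by
    intro x y hxy
    rw [← Subtype.coe_le_coe]
    by_cases hx : x ∈ J <;> by_cases hy : y ∈ J
    · rw [ρ1 x hx, ρ1 y hy]
    · rw [ρ1 x hx, ρ2 y hy]
      by_contra hc
      exact hy (hJ.2.1 x p y hx hp hxy (not_le.1 hc).le)
    · rw [ρ2 x hx, ρ1 y hy]
      by_contra hc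
      exact hx (hJ.2.1 p y x hp hy (not_le.1 hc).le hxy)
    · rw [ρ2 x hx, ρ2 y hy]; exact hxy
  have hρs : Function.Surjective ρ := by
    rintro ⟨i, hi⟩
    refine ⟨i, Subtype.ext ?_⟩
    rcases (hR i).1 hi with rfl | h
    · exact ρ1 _ hp
    · exact ρ2 _ h
  have hρv : ∀ x y, ρ x ≠ ρ y → (σ x < σ y ↔ σ (ρ x) < σ (ρ y)) := by
    intro x y hxy
    by_cases hx : x ∈ J <;> by_cases hy : y ∈ J
    · exact absurd (Subtype.ext ((ρ1 x hx).trans (ρ1 y hy).symm)) hxy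
    · rw [ρ1 x hx, ρ2 y hy]
      constructor
      · intro h
        by_contra hc
        exact hy (hJ.2.2 x p y hx hp h.le (not_lt.1 hc))
      · intro h
        by_contra hc
        exact hy (hJ.2.2 p x y hp hx h.le (not_lt.1 hc))
    · rw [ρ2 x hx, ρ1 y hy]
      constructor
      · intro h
        by_contra hc
        exact hx (hJ.2.2 p y x hp hy (not_lt.1 hc) h.le)
      · intro h
        by_contra hc
        exact hx (hJ.2.2 y p x hy hp (not_lt.1 hc) h.le)
    · rw [ρ2 x hx, ρ2 y hy]
  obtain ⟨τ, hτ⟩ := standardize (fun k => σ (E k : Fin s))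
    (σ.injective.comp (Subtype.val_injective.comp E.injective))
  have hval : ∀ x y, ρ x ≠ ρ y → (σ x < σ y ↔ τ (E.symm (ρ x)) < τ (E.symm (ρ y))) := by
    intro x y hxy
    rw [hτ, hρv x y hxy]
    simp
  refine ⟨R.card, τ, fun i => E.symm (ρ i), ?_, ?_, ?_, ?_, ?_, ?_⟩
  · have : ({p, r} : Finset (Fin s)) ⊆ R := by
      intro i hi
      rw [hR]
      simp only [Finset.mem_insert, Finset.mem_singleton] at hi
      rcases hi with rfl | rfl
      · exact Or.inl rfl
      · exact Or.inr hr
    have h3 := Finset.card_le_card this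
    rwa [Finset.card_pair (show p ≠ r from fun h => hr (h ▸ hp))] at h3
  · have : R ⊂ Finset.univ := by
      rw [Finset.ssubset_univ_iff]
      intro h
      have : q ∈ R := by rw [h]; simp
      rcases (hR q).1 this with h | h
      · exact hqp h
      · exact h hq
    simpa using Finset.card_lt_card this
  · exact E.symm.monotone.comp hρm
  · exact E.symm.surjective.comp hρs
  · intro x y hxy
    exact hval x y (fun h => by simp [h] at hxy)
  · intro x y z hxy h1 h2
    have hxy' : ρ x = ρ y := E.symm.injective hxy
    by_contra hc
    have hzx : ρ z ≠ ρ x := fun h => hc (by simp [h])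
    have hzy : ρ z ≠ ρ y := hxy' ▸ hzx
    have a1 : σ x < σ z := lt_of_le_of_ne h1 (fun h => hzx (by rw [σ.injective h]))
    have a2 : σ z < σ y := lt_of_le_of_ne h2 (fun h => hzy (by rw [σ.injective h]))
    have b1 := (hρv x z hzx.symm).1 a1
    have b2 := (hρv z y hzy).1 a2
    rw [← hxy'] at b2
    exact lt_asymm b1 b2

theorem bm_comp {n s t : ℕ} {π : Equiv.Perm (Fin n)} {σ : Equiv.Perm (Fin s)}
    {τ : Equiv.Perm (Fin t)} {c : Fin n → Fin s} {d : Fin s → Fin t}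
    (h : IsBlockMap π σ c) (h' : IsBlockMap σ τ d) : IsBlockMap π τ (d ∘ c) := by
  have hv : ∀ a b, d (c a) ≠ d (c b) → (π a < π b ↔ τ (d (c a)) < τ (d (c b))) := by
    intro a b hab
    rw [bm_val h (fun e => hab (by rw [e])), bm_val h' hab]
  refine ⟨h'.1.comp h.1, h'.2.1.comp h.2.1, fun a b hab => hv a b hab.ne, ?_⟩
  intro x y z hxy h1 h2
  simp only [Function.comp] at *
  by_contra hc
  have hzy : d (c z) ≠ d (c y) := hxy ▸ hc
  have a1 : π x < π z := lt_of_le_of_ne h1 (fun h => hc (by rw [π.injective h]))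
  have a2 : π z < π y := lt_of_le_of_ne h2 (fun h => hzy (by rw [π.injective h]))
  have b1 := (hv x z (Ne.symm hc)).1 a1
  have b2 := (hv z y hzy).1 a2
  rw [← hxy] at b2
  exact lt_asymm b1 b2

theorem exists_simple (s : ℕ) : ∀ {n : ℕ} (π : Equiv.Perm (Fin n)) (σ : Equiv.Perm (Fin s))
    (c : Fin n → Fin s), 2 ≤ s → IsBlockMap π σ c →
    ∃ (s : ℕ) (σ : Equiv.Perm (Fin s)) (c : Fin n → Fin s),
      2 ≤ s ∧ IsSimplePerm σ ∧ IsBlockMap π σ c := by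
  induction s using Nat.strong_induction_on with
  | _ s ih =>
    intro n π σ c hs h
    by_cases hσ : IsSimplePerm σ
    · exact ⟨s, σ, c, hs, hσ, h⟩
    · obtain ⟨t, τ, d, ht, hts, hd⟩ := contract σ hσ
      exact ih t hts π τ (d ∘ c) ht (bm_comp h hd)

/-- Substitution decomposition (Albert–Atkinson): every permutation of length
`n ≥ 2` is the inflation of a simple permutation `σ` (of length `≥ 2`); the
simple permutation is unique (up to order isomorphism of the index sets), and
if `|σ| ≥ 4` then the intervals of the decomposition are also unique. -/
theorem stmt16 {n : ℕ} (hn : 2 ≤ n) (π : Equiv.Perm (Fin n)) :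
    (∃ (s : ℕ) (σ : Equiv.Perm (Fin s)) (c : Fin n → Fin s),
      2 ≤ s ∧ IsSimplePerm σ ∧ IsBlockMap π σ c) ∧
    (∀ (s₁ s₂ : ℕ) (σ₁ : Equiv.Perm (Fin s₁)) (σ₂ : Equiv.Perm (Fin s₂))
        (c₁ : Fin n → Fin s₁) (c₂ : Fin n → Fin s₂),
      2 ≤ s₁ → 2 ≤ s₂ → IsSimplePerm σ₁ → IsSimplePerm σ₂ →
      IsBlockMap π σ₁ c₁ → IsBlockMap π σ₂ c₂ →
      ∃ e : Fin s₁ ≃o Fin s₂, ∀ a : Fin s₁, σ₂ (e a) = e (σ₁ a)) ∧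
    (∀ (s : ℕ) (σ : Equiv.Perm (Fin s)) (c₁ c₂ : Fin n → Fin s),
      4 ≤ s → IsSimplePerm σ → IsBlockMap π σ c₁ → IsBlockMap π σ c₂ →
      c₁ = c₂) := by
  refine ⟨?_, ?_, ?_⟩
  · refine exists_simple n π π id hn ⟨monotone_id, Function.surjective_id, ?_, ?_⟩
    · intro a b _
      rfl
    · rintro a b e hab h1 h2
      have hab' : a = b := hab
      subst hab'
      exact π.injective (le_antisymm h2 h1)
  · intro s₁ s₂ σ₁ σ₂ c₁ c₂ hs₁ hs₂ hσ₁ hσ₂ h₁ h₂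
    obtain ⟨e, he, _⟩ := uniq hs₁ hs₂ hσ₁ hσ₂ h₁ h₂
    exact ⟨e, he⟩
  · intro s σ c₁ c₂ hs hσ h₁ h₂
    obtain ⟨e, _, he | he⟩ := uniq (by omega) (by omega) hσ hσ h₁ h₂
    · omega
    · have : e = OrderIso.refl _ := Subsingleton.elim _ _
      subst this
      funext x
      exact (he x).symm
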